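/- Fix α ∈ (0,1), set k := max{6, −6/log₂(1−α)}, and for β ∈ (0,1) set m := ⌊−k log₂ β⌋. For every ε > 0 there exist constants K > 0 and β₀ > 0 such that for all β ∈ (0, β₀) and all integers n > m: P(D_0^n is typical) ≥ 1 − K β^{2−ε}. -/

import Mathlib

open Filter

noncomputable section

open scoped Classical

namespace SyncDeletion

/-- The deletion output `y(x, d)`: the subsequence of `x` consisting of the bits `x i`
with `d i = false`, in order. -/
def yList (x d : List Bool) : List Bool :=
  ((x.zip d).filter (fun p => p.2 = false)).map Prod.fst

/-- Binary entropy function (base-2), with `binEnt 0 = binEnt 1 = 0`. -/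
def binEnt (p : ℝ) : ℝ := -(p * Real.logb 2 p) - (1 - p) * Real.logb 2 (1 - p)

/-- The constant `C = ∑_{l≥1} 2^{-l-1} l log₂ l` (the `l = 0` term vanishes). -/
def Cconst : ℝ := ∑' l : ℕ, (2 : ℝ) ^ (-(l : ℝ) - 1) * (l : ℝ) * Real.logb 2 (l : ℝ)

/-- Probability of an event `E` under a pmf `p` on a finite outcome space. -/
def prob {Ω : Type} [Fintype Ω] (p : Ω → ℝ) (E : Ω → Prop) : ℝ :=
  ∑ ω ∈ Finset.univ.filter E, p ω

/-- Conditional Shannon entropy (in bits) `H(f | g)` of the random variable `f`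
given `g`, under the pmf `p`. -/
def condEnt {Ω A B : Type} [Fintype Ω] (p : Ω → ℝ) (f : Ω → A) (g : Ω → B) : ℝ :=
  -∑ ab ∈ Finset.univ.image (fun ω => (f ω, g ω)),
    (if prob p (fun ω => f ω = ab.1 ∧ g ω = ab.2) = 0 then 0
     else prob p (fun ω => f ω = ab.1 ∧ g ω = ab.2) *
       Real.logb 2 (prob p (fun ω => f ω = ab.1 ∧ g ω = ab.2) /
         prob p (fun ω => g ω = ab.2)))

/-- Shannon entropy (in bits) `H(f)` of the random variable `f` under the pmf `p`. -/
def ent {Ω A : Type} [Fintype Ω] (p : Ω → ℝ) (f : Ω → A) : ℝ :=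
  condEnt p f (fun _ => ())

/-- Stationary initial distribution of the deletion-pattern Markov chain:
`P(D₀ = 1) = β/(α+β)`. -/
def initD (α β : ℝ) (b : Bool) : ℝ := if b then β / (α + β) else α / (α + β)

/-- Transition probabilities of the deletion-pattern Markov chain:
`P(1|1) = 1-α`, `P(0|1) = α`, `P(1|0) = β`, `P(0|0) = 1-β`. -/
def transD (α β : ℝ) (b b' : Bool) : ℝ :=
  if b then (if b' then 1 - α else α) else (if b' then β else 1 - β)

/-- Probability of a trajectory of the stationary two-state Markov chain. -/
def pMarkov (α β : ℝ) {m : ℕ} (dp : Fin (m + 1) → Bool) : ℝ :=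
  initD α β (dp 0) * ∏ i : Fin m, transD α β (dp i.castSucc) (dp i.succ)

/-- Joint pmf of the iid Bernoulli(1/2) source `X^n = ω.1` and the independent
deletion pattern `(D_0, …, D_{n+1}) = ω.2`. -/
def pJoint (α β : ℝ) (n : ℕ) (ω : (Fin n → Bool) × (Fin (n + 2) → Bool)) : ℝ :=
  (1 / 2 : ℝ) ^ n * pMarkov α β (m := n + 1) ω.2

/-- The deletion output `y(X^n, D^n)`: bits `X_i` with `D_i = 0` in order
(source bit `X_i` is governed by pattern bit `D_i`, i.e. index `i` of `ω.2`,
for `i = 1, …, n`). -/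
def yOut {n : ℕ} (ω : (Fin n → Bool) × (Fin (n + 2) → Bool)) : List Bool :=
  yList (List.ofFn ω.1)
    (List.ofFn (fun i : Fin n => ω.2 ⟨i.val + 1, by have := i.isLt; omega⟩))

/-- `a_n = H(X^n | y(X^n, D^n), D_0, D_{n+1})`. -/
def aSeq (α β : ℝ) (n : ℕ) : ℝ :=
  condEnt (pJoint α β n) (fun ω => ω.1)
    (fun ω => (yOut ω, ω.2 0, ω.2 (Fin.last (n + 1))))

/-- `E_n = H(D_1 | D_0, X^n, y(X^n, D^n), D_{n+1})`. -/
def Eseq (α β : ℝ) (n : ℕ) : ℝ :=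
  condEnt (pJoint α β n) (fun ω => ω.2 1)
    (fun ω => (ω.2 0, ω.1, yOut ω, ω.2 (Fin.last (n + 1))))

/-- `H(y(X^n, D^n) | X^n, D_0, D_{n+1})`. -/
def hygSeq (α β : ℝ) (n : ℕ) : ℝ :=
  condEnt (pJoint α β n) (fun ω => yOut ω)
    (fun ω => (ω.1, ω.2 0, ω.2 (Fin.last (n + 1))))

/-- `J_n = d + (1/n) H(y(X^n, D^n) | X^n, D_0, D_{n+1})` with `d = β/(α+β)`. -/
def Jseq (α β : ℝ) (n : ℕ) : ℝ := β / (α + β) + hygSeq α β n / n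

/-- `I_n/n`: the normalized mutual information
`(1/n)(H(y(X^n,D^n)) - H(y(X^n,D^n)|X^n))`. -/
def Iseq (α β : ℝ) (n : ℕ) : ℝ :=
  (ent (pJoint α β n) (fun ω => yOut ω) -
    condEnt (pJoint α β n) (fun ω => yOut ω) (fun ω => ω.1)) / n

/-- Error probability of a code `(enc, dec)` with message set `Fin M`. -/
def errProb (α β : ℝ) (n M : ℕ) (enc : (Fin n → Bool) → Fin M)
    (dec : Fin M × List Bool → (Fin n → Bool)) : ℝ :=
  prob (pJoint α β n) (fun ω => dec (enc ω.1, yOut ω) ≠ ω.1)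

/-- `R` is an achievable rate: there is a sequence of codes whose error probability
tends to `0` and whose rate `(1/n) log₂ |M_n|` has limsup at most `R`. -/
def IsAchievable (α β R : ℝ) : Prop :=
  ∃ M : ℕ → ℕ, ∃ enc : (n : ℕ) → (Fin n → Bool) → Fin (M n),
    ∃ dec : (n : ℕ) → Fin (M n) × List Bool → (Fin n → Bool),
      Tendsto (fun n => errProb α β n (M n) (enc n) (dec n)) atTop (nhds 0) ∧
      Filter.limsup (fun n : ℕ => Real.logb 2 (M n : ℝ) / (n : ℝ)) atTop ≤ R

/-- The minimum achievable rate `R_min(α, β)`. -/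
def Rmin (α β : ℝ) : ℝ := sInf {R : ℝ | IsAchievable α β R}

/-- `k = max {6, -6 / log₂(1-α)}`. -/
def kconst (α : ℝ) : ℝ := max 6 (-6 / Real.logb 2 (1 - α))

/-- `m = ⌊-k log₂ β⌋`. -/
def mlen (α β : ℝ) : ℕ := ⌊kconst α * (-Real.logb 2 β)⌋₊

/-- Number of ones among the entries of `dp` with index `≤ m`. -/
def onesCount {N : ℕ} (dp : Fin N → Bool) (m : ℕ) : ℕ :=
  (Finset.univ.filter (fun i : Fin N => i.val ≤ m ∧ dp i = true)).card

/-- Number of maximal runs of 1's among the entries of `dp` with index `≤ m`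
(counted by their starting positions). -/
def runsCount {N : ℕ} (dp : Fin N → Bool) (m : ℕ) : ℕ :=
  (Finset.univ.filter (fun i : Fin N => i.val ≤ m ∧ dp i = true ∧
    (i.val = 0 ∨ dp ⟨i.val - 1, lt_of_le_of_lt (Nat.sub_le _ _) i.isLt⟩ = false))).card

/-- The deletion pattern `(D_0, …, D_{n+1})` is typical: `(D_0, …, D_m)` contains at
most one maximal run of 1's and at most `⌊(k/3)(-log₂ β)⌋` ones, for `m = ⌊-k log₂ β⌋`. -/
def Typical (α β : ℝ) {n : ℕ} (dp : Fin (n + 2) → Bool) : Prop :=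
  runsCount dp (mlen α β) ≤ 1 ∧
    onesCount dp (mlen α β) ≤ ⌊(kconst α / 3) * (-Real.logb 2 β)⌋₊

/-- The joint pmf conditioned on the event `{T = 1}` that the deletion pattern is typical. -/
def pTypCond (α β : ℝ) (n : ℕ) (ω : (Fin n → Bool) × (Fin (n + 2) → Bool)) : ℝ :=
  if Typical α β ω.2 then
    pJoint α β n ω / prob (pJoint α β n) (fun ω' => Typical α β ω'.2)
  else 0

/-- `H(D_1 | X^n, y(X^n,D^n), D_0, D_{n+1}, T = 1) ⬝ P(T = 1)`. -/
def EseqTyp (α β : ℝ) (n : ℕ) : ℝ :=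
  condEnt (pTypCond α β n) (fun ω => ω.2 1)
    (fun ω => (ω.2 0, ω.1, yOut ω, ω.2 (Fin.last (n + 1)))) *
  prob (pJoint α β n) (fun ω => Typical α β ω.2)

/-- `(1/k) H(X_2^{k-1} | y(X_2^{k-1}, D_2^{k-1}), D_1, D_k)` (unnormalized). -/
def innerEnt (α β : ℝ) (k : ℕ) : ℝ :=
  condEnt (pJoint α β k)
    (fun ω => (fun i : Fin (k - 2) => ω.1 ⟨i.val + 1, by have := i.isLt; omega⟩))
    (fun ω =>
      (yList (List.ofFn (fun i : Fin (k - 2) => ω.1 ⟨i.val + 1, by have := i.isLt; omega⟩))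
        (List.ofFn (fun i : Fin (k - 2) => ω.2 ⟨i.val + 2, by have := i.isLt; omega⟩)),
       ω.2 1, ω.2 ⟨k, by omega⟩))


/-- Peeling off the first state of a path weight. -/
lemma sum_path_succ (m : ℕ) (ι : Bool → ℝ) (W : ℕ → Bool → Bool → ℝ) :
    ∑ dp : Fin (m + 2) → Bool,
        ι (dp 0) * ∏ i : Fin (m + 1), W i (dp i.castSucc) (dp i.succ)
      = ∑ dp : Fin (m + 1) → Bool,
        (∑ b, ι b * W 0 b (dp 0)) *
          ∏ i : Fin m, W (i + 1) (dp i.castSucc) (dp i.succ) := by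
  rw [← (Fin.consEquiv (fun _ : Fin (m + 2) => Bool)).sum_comp, Fintype.sum_prod_type,
    Finset.sum_comm]
  refine Finset.sum_congr rfl fun dp _ => ?_
  rw [Finset.sum_mul]
  refine Finset.sum_congr rfl fun b _ => ?_
  simp only [Fin.consEquiv_apply]
  rw [Fin.prod_univ_succ]
  simp [mul_assoc]

/-- The total path weight is at most the initial mass times the bounds on the row sums. -/
lemma sum_path_le (m : ℕ) (ι : Bool → ℝ) (W : ℕ → Bool → Bool → ℝ) (c : ℕ → ℝ)
    (hι : ∀ b, 0 ≤ ι b) (hW : ∀ i b b', 0 ≤ W i b b') (hc : ∀ i b, ∑ b', W i b b' ≤ c i) :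
    ∑ dp : Fin (m + 1) → Bool, ι (dp 0) * ∏ i : Fin m, W i (dp i.castSucc) (dp i.succ)
      ≤ (∑ b, ι b) * ∏ i ∈ Finset.range m, c i := by
  induction m generalizing ι W c with
  | zero =>
    rw [← (Equiv.funUnique (Fin 1) Bool).symm.sum_comp]
    simp
  | succ m ih =>
    have hc0 : ∀ i, 0 ≤ c i := fun i =>
      (Finset.sum_nonneg fun b' _ => hW i true b').trans (hc i true)
    rw [sum_path_succ]
    refine (ih (fun b' => ∑ b, ι b * W 0 b b') (fun i => W (i + 1)) (fun i => c (i + 1))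
      (fun b' => Finset.sum_nonneg fun b _ => mul_nonneg (hι b) (hW _ _ _))
      (fun _ => hW _) (fun _ => hc _)).trans ?_
    rw [Finset.prod_range_succ', mul_comm (∏ _ ∈ _, _) (c 0), ← mul_assoc]
    refine mul_le_mul_of_nonneg_right ?_ (Finset.prod_nonneg fun i _ => hc0 _)
    rw [Finset.sum_comm, Finset.sum_mul]
    refine Finset.sum_le_sum fun b _ => ?_
    rw [← Finset.mul_sum]
    exact mul_le_mul_of_nonneg_left (hc 0 b) (hι b)

/-- Stochastic transition weights preserve the initial mass. -/
lemma sum_path_eq (m : ℕ) (ι : Bool → ℝ) (W : ℕ → Bool → Bool → ℝ)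
    (hW : ∀ i b, ∑ b', W i b b' = 1) :
    ∑ dp : Fin (m + 1) → Bool, ι (dp 0) * ∏ i : Fin m, W i (dp i.castSucc) (dp i.succ)
      = ∑ b, ι b := by
  induction m generalizing ι W with
  | zero =>
    rw [← (Equiv.funUnique (Fin 1) Bool).symm.sum_comp]
    simp
  | succ m ih =>
    rw [sum_path_succ, ih (fun b' => ∑ b, ι b * W 0 b b') (fun i => W (i + 1)) (fun _ => hW _),
      Finset.sum_comm]
    simp only [← Finset.mul_sum, hW, mul_one]

lemma sum_transD (α β : ℝ) (b : Bool) : ∑ b', transD α β b b' = 1 := by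
  cases b <;> simp [transD]

section Chain

variable {α β : ℝ}

lemma initD_nonneg (hα0 : 0 < α) (hβ0 : 0 < β) (b : Bool) : 0 ≤ initD α β b := by
  unfold initD; split_ifs <;> positivity

lemma sum_initD (hα0 : 0 < α) (hβ0 : 0 < β) : ∑ b, initD α β b = 1 := by
  simp [initD]; field_simp; ring

lemma transD_nonneg (hα0 : 0 < α) (hα1 : α < 1) (hβ0 : 0 < β) (hβ1 : β < 1) (b b' : Bool) :
    0 ≤ transD α β b b' := by
  unfold transD; split_ifs <;> linarith

lemma pMarkov_nonneg (hα0 : 0 < α) (hα1 : α < 1) (hβ0 : 0 < β) (hβ1 : β < 1) {m : ℕ}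
    (dp : Fin (m + 1) → Bool) : 0 ≤ pMarkov α β dp :=
  mul_nonneg (initD_nonneg hα0 hβ0 _)
    (Finset.prod_nonneg fun _ _ => transD_nonneg hα0 hα1 hβ0 hβ1 _ _)

lemma sum_pMarkov (hα0 : 0 < α) (hβ0 : 0 < β) (m : ℕ) :
    ∑ dp : Fin (m + 1) → Bool, pMarkov α β dp = 1 :=
  (sum_path_eq m (initD α β) (fun _ => transD α β) (fun _ => sum_transD α β)).trans
    (sum_initD hα0 hβ0)

/-- A path extended by `false` to all indices. -/
def extend {N : ℕ} (dp : Fin N → Bool) (i : ℕ) : Bool :=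
  if h : i < N then dp ⟨i, h⟩ else false

/-- A maximal run of ones of `g` starts at index `i`. -/
def IsRunStart (g : ℕ → Bool) (i : ℕ) : Prop :=
  g i = true ∧ (i = 0 ∨ g (i - 1) = false)

lemma extend_val {N : ℕ} (dp : Fin N → Bool) (i : Fin N) : extend dp i = dp i := by
  simp [extend]

/-- The probability that a run of ones starts at `i` and that the later transitions in `S`
all go from `p` to `p'`. -/
lemma prob_runStart_and_le (hα0 : 0 < α) (hα1 : α < 1) (hβ0 : 0 < β) (hβ1 : β < 1) {m i : ℕ}
    (him : i ≤ m) (S : Finset ℕ) (hS : ∀ e ∈ S, i ≤ e ∧ e < m) (p p' : Bool) :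
    prob (pMarkov α β (m := m)) (fun dp => IsRunStart (extend dp) i ∧
        ∀ e ∈ S, extend dp e = p ∧ extend dp (e + 1) = p')
      ≤ β / α * transD α β p p' ^ S.card := by
  have hT := transD_nonneg hα0 hα1 hβ0 hβ1
  let ι : Bool → ℝ := fun b => if i = 0 → b = true then initD α β b else 0
  let W : ℕ → Bool → Bool → ℝ := fun e b b' =>
    if (e + 1 = i → b = false ∧ b' = true) ∧ (e ∈ S → b = p ∧ b' = p')
    then transD α β b b' else 0
  let c : ℕ → ℝ := fun e => (if e + 1 = i then β else 1) *
    (if e ∈ S then transD α β p p' else 1)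
  have hι : ∀ b, 0 ≤ ι b := fun b => by
    simp only [ι]; split_ifs <;> first | exact initD_nonneg hα0 hβ0 b | exact le_rfl
  have hW : ∀ e b b', 0 ≤ W e b b' := fun e b b' => by
    simp only [W]; split_ifs <;> first | exact hT b b' | exact le_rfl
  have hc : ∀ e b, ∑ b', W e b b' ≤ c e := by
    intro e b
    by_cases h1 : e + 1 = i
    · have h2 : e ∉ S := fun h => by have := (hS e h).1; omega
      cases b <;> simp [W, c, h1, h2, transD, hβ0.le]
    · by_cases h2 : e ∈ S
      · have := hT p p'
        cases b <;> cases p <;> cases p' <;> simp_all [W, c]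
      · have := sum_transD α β b
        simp_all [W, c]
  have hle : prob (pMarkov α β (m := m)) (fun dp => IsRunStart (extend dp) i ∧
        ∀ e ∈ S, extend dp e = p ∧ extend dp (e + 1) = p')
      ≤ ∑ dp : Fin (m + 1) → Bool,
        ι (dp 0) * ∏ i : Fin m, W i (dp i.castSucc) (dp i.succ) := by
    unfold prob
    rw [Finset.sum_filter]
    refine Finset.sum_le_sum fun dp _ => ?_
    split_ifs with h
    · obtain ⟨⟨h1, h2⟩, h3⟩ := h
      refine le_of_eq ?_
      unfold pMarkov
      congr 1
      · have : i = 0 → dp 0 = true := by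
          rintro rfl
          simpa [extend] using h1
        simp only [ι]
        rw [if_pos this]
      · refine Finset.prod_congr rfl fun e _ => ?_
        have hb : extend dp e = dp e.castSucc := extend_val dp e.castSucc
        have hb' : extend dp (e + 1) = dp e.succ := extend_val dp e.succ
        simp only [W]
        rw [if_pos]
        rw [← hb, ← hb']
        refine ⟨?_, h3 e⟩
        intro he
        rw [← he] at h1 h2
        exact ⟨by simpa using h2, h1⟩
    · exact mul_nonneg (hι _) (Finset.prod_nonneg fun _ _ => hW _ _ _)
  refine hle.trans ((sum_path_le m ι W c hι hW hc).trans ?_)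
  have hprodS : ∏ e ∈ Finset.range m, (if e ∈ S then transD α β p p' else 1)
      = transD α β p p' ^ S.card := by
    have hsub : Finset.range m ∩ S = S :=
      Finset.inter_eq_right.2 fun e he => Finset.mem_range.2 (hS e he).2
    rw [Finset.prod_ite_mem, hsub, Finset.prod_const]
  simp only [c]
  rw [Finset.prod_mul_distrib, hprodS, ← mul_assoc]
  refine mul_le_mul_of_nonneg_right ?_ (pow_nonneg (hT p p') _)
  rcases Nat.eq_zero_or_pos i with rfl | hi
  · have : β / (α + β) ≤ β / α := by gcongr; linarith
    simpa [ι, initD] using this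
  · have h1 : ∑ b, ι b = 1 := by
      simpa [ι, hi.ne'] using sum_initD hα0 hβ0
    have h2 : ∏ e ∈ Finset.range m, (if e + 1 = i then β else 1) = β := by
      rw [Finset.prod_eq_single (i - 1)]
      · rw [if_pos (by omega)]
      · intro e _ he
        rw [if_neg (by omega)]
      · intro h
        exact absurd (Finset.mem_range.2 (by omega)) h
    rw [h1, h2, one_mul, le_div_iff₀ hα0]
    nlinarith

end Chain

/-- Union bound. -/
lemma prob_le_sum_prob {Ω A : Type} [Fintype Ω] {p : Ω → ℝ} (hp : ∀ ω, 0 ≤ p ω)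
    (s : Finset A) {E : Ω → Prop} (F : A → Ω → Prop) (h : ∀ ω, E ω → ∃ a ∈ s, F a ω) :
    prob p E ≤ ∑ a ∈ s, prob p (F a) := by
  simp only [prob, Finset.sum_filter]
  rw [Finset.sum_comm]
  refine Finset.sum_le_sum fun ω _ => ?_
  have hnn : ∀ a ∈ s, 0 ≤ if F a ω then p ω else 0 := fun a _ => by
    split_ifs <;> first | exact hp ω | exact le_rfl
  split_ifs with hE
  · obtain ⟨a, ha, hF⟩ := h ω hE
    refine le_trans ?_ (Finset.single_le_sum hnn ha)
    rw [if_pos hF]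
  · exact Finset.sum_nonneg hnn

lemma prob_le_add_prob {Ω : Type} [Fintype Ω] {p : Ω → ℝ} (hp : ∀ ω, 0 ≤ p ω)
    {E F G : Ω → Prop} (h : ∀ ω, E ω → F ω ∨ G ω) :
    prob p E ≤ prob p F + prob p G := by
  refine (prob_le_sum_prob hp Finset.univ (fun b : Bool => if b then F else G)
    fun ω hω => ?_).trans (by simp)
  rcases h ω hω with h | h
  · exact ⟨true, by simpa using h⟩
  · exact ⟨false, by simpa using h⟩

lemma prob_add_prob_not {Ω : Type} [Fintype Ω] (p : Ω → ℝ) (E : Ω → Prop) :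
    prob p E + prob p (fun ω => ¬ E ω) = ∑ ω, p ω := by
  simp only [prob, Finset.sum_filter, ← Finset.sum_add_distrib]
  refine Finset.sum_congr rfl fun ω _ => ?_
  by_cases h : E ω <;> simp [h]

lemma prob_eq_zero {Ω : Type} [Fintype Ω] (p : Ω → ℝ) {E : Ω → Prop} (h : ∀ ω, ¬ E ω) :
    prob p E = 0 := by
  simp [prob, h]

/-- An event on the deletion pattern has the same probability under the joint law. -/
lemma prob_pJoint_snd (α β : ℝ) (n : ℕ) (E : (Fin (n + 2) → Bool) → Prop) :
    prob (pJoint α β n) (fun ω => E ω.2) = prob (pMarkov α β (m := n + 1)) E := by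
  simp only [prob, Finset.sum_filter, pJoint]
  rw [Fintype.sum_prod_type]
  simp only [Finset.sum_const, Finset.card_univ, Fintype.card_fun, Fintype.card_bool,
    Fintype.card_fin, nsmul_eq_mul]
  rw [Finset.mul_sum]
  refine Finset.sum_congr rfl fun dp _ => ?_
  split_ifs
  · rw [← mul_assoc]
    push_cast
    rw [← mul_pow]
    norm_num
  · simp

/-- If there is no pair of run starts and more than `t` ones, then some run of ones has
length more than `t`. -/
lemma exists_long_run {g : ℕ → Bool} {m t : ℕ}
    (hpair : ∀ i j, i < j → j ≤ m → IsRunStart g i → ¬ IsRunStart g j)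
    (hones : t < ((Finset.range (m + 1)).filter fun i => g i = true).card) :
    ∃ i, i + t ≤ m ∧ IsRunStart g i ∧ ∀ e, i ≤ e → e ≤ i + t → g e = true := by
  have hne : ∃ i, i ≤ m ∧ g i = true := by
    obtain ⟨i, hi⟩ := Finset.card_pos.1 (lt_of_le_of_lt (Nat.zero_le t) hones)
    simp only [Finset.mem_filter, Finset.mem_range] at hi
    exact ⟨i, by omega, hi.2⟩
  obtain ⟨him, hgi⟩ := Nat.find_spec hne
  have hmin : ∀ f, f < Nat.find hne → f ≤ m → g f = false := fun f hf hfm => by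
    have := Nat.find_min hne hf
    simpa [hfm] using this
  generalize Nat.find hne = i at him hgi hmin
  have hstart : IsRunStart g i := by
    refine ⟨hgi, ?_⟩
    rcases Nat.eq_zero_or_pos i with h | h
    · exact Or.inl h
    · exact Or.inr (hmin _ (by omega) (by omega))
  have hend : ∀ e, i ≤ e → (∀ f, e ≤ f → f ≤ m → g f = false) → i + t < e := by
    intro e hie he
    have hsub : ((Finset.range (m + 1)).filter fun i => g i = true) ⊆ Finset.Ico i e := by
      intro f hf
      simp only [Finset.mem_filter, Finset.mem_range] at hf
      rw [Finset.mem_Ico]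
      by_contra hcon
      have hff : g f = false := by
        rcases lt_or_ge f i with h | h
        · exact hmin f h (by omega)
        · exact he f (by omega) (by omega)
      simp [hff] at hf
    have := Finset.card_le_card hsub
    rw [Nat.card_Ico] at this
    omega
  refine ⟨i, ?_, hstart, ?_⟩
  · have := hend (m + 1) (by omega) (fun f _ _ => by omega)
    omega
  · intro e hie het
    by_contra hge
    rw [Bool.not_eq_true] at hge
    refine absurd (hend e hie fun f hef => ?_) (by omega)
    induction f, hef using Nat.le_induction with
    | base => exact fun _ => hge
    | succ f hef ih =>
      intro hfm
      by_contra hgf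
      rw [Bool.not_eq_false] at hgf
      exact hpair i (f + 1) (by omega) hfm hstart ⟨hgf, Or.inr (ih (by omega))⟩

lemma onesCount_eq {N m : ℕ} (hm : m < N) (dp : Fin N → Bool) :
    onesCount dp m = ((Finset.range (m + 1)).filter fun i => extend dp i = true).card := by
  unfold onesCount
  refine Finset.card_bij (fun i _ => i.val) ?_ (fun _ _ _ _ h => Fin.ext h) ?_
  · intro i hi
    simp only [Finset.mem_filter, Finset.mem_univ, true_and, Finset.mem_range] at hi ⊢
    rw [extend_val]
    exact ⟨by omega, hi.2⟩
  · intro i hi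
    simp only [Finset.mem_filter, Finset.mem_range] at hi
    refine ⟨⟨i, by omega⟩, ?_, rfl⟩
    simp only [Finset.mem_filter, Finset.mem_univ, true_and]
    exact ⟨by omega, (extend_val dp ⟨i, by omega⟩).symm.trans hi.2⟩

lemma exists_runStart_pair {N m : ℕ} (dp : Fin N → Bool) (h : 1 < runsCount dp m) :
    ∃ i j, i < j ∧ j ≤ m ∧ IsRunStart (extend dp) i ∧ IsRunStart (extend dp) j := by
  obtain ⟨a, ha, b, hb, hab⟩ := Finset.one_lt_card.1 h
  have key : ∀ a : Fin N, (a.val ≤ m ∧ dp a = true ∧ (a.val = 0 ∨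
      dp ⟨a.val - 1, lt_of_le_of_lt (Nat.sub_le _ _) a.isLt⟩ = false)) →
      a.val ≤ m ∧ IsRunStart (extend dp) a := by
    rintro a ⟨h1, h2, h3⟩
    refine ⟨h1, by rwa [extend_val], h3.imp_right fun h => ?_⟩
    rw [← h]
    exact extend_val dp ⟨a.val - 1, _⟩
  obtain ⟨ham, ha⟩ := key a (by simpa using ha)
  obtain ⟨hbm, hb⟩ := key b (by simpa using hb)
  rcases lt_or_gt_of_ne (Fin.val_ne_of_ne hab) with h | h
  · exact ⟨a, b, h, hbm, ha, hb⟩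
  · exact ⟨b, a, h, ham, hb, ha⟩

/-- The threshold on the number of ones. -/
def onesBound (α β : ℝ) : ℕ := ⌊(kconst α / 3) * (-Real.logb 2 β)⌋₊

lemma prob_not_typical_le {α β : ℝ} (hα0 : 0 < α) (hα1 : α < 1) (hβ0 : 0 < β) (hβ1 : β < 1)
    {n : ℕ} (hn : mlen α β < n) :
    prob (pMarkov α β (m := n + 1)) (fun dp => ¬ Typical α β dp)
      ≤ ((mlen α β : ℝ) + 1) ^ 2 * (β / α * β)
        + ((mlen α β : ℝ) + 1) * (β / α * (1 - α) ^ onesBound α β) := by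
  set m := mlen α β with hm
  set t := onesBound α β with ht
  have hp : ∀ dp : Fin (n + 1 + 1) → Bool, 0 ≤ pMarkov α β dp :=
    pMarkov_nonneg hα0 hα1 hβ0 hβ1
  let A : ℕ × ℕ → (Fin (n + 1 + 1) → Bool) → Prop := fun ij dp => ij.1 < ij.2 ∧
    IsRunStart (extend dp) ij.1 ∧ IsRunStart (extend dp) ij.2
  let B : ℕ → (Fin (n + 1 + 1) → Bool) → Prop := fun i dp =>
    i + t ≤ m ∧ IsRunStart (extend dp) i ∧ ∀ e, i ≤ e → e ≤ i + t → extend dp e = true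
  have hmono : ∀ E F : (Fin (n + 1 + 1) → Bool) → Prop, (∀ dp, E dp → F dp) →
      prob (pMarkov α β) E ≤ prob (pMarkov α β) F := fun E F h => by
    simpa using prob_le_sum_prob hp {()} (fun _ => F) (fun dp hdp => ⟨(), by simp, h dp hdp⟩)
  have hA : ∀ ij ∈ Finset.range (m + 1) ×ˢ Finset.range (m + 1),
      prob (pMarkov α β) (A ij) ≤ β / α * β := by
    rintro ⟨i, j⟩ hij
    simp only [Finset.mem_product, Finset.mem_range] at hij
    by_cases hlt : i < j
    · have := prob_runStart_and_le (m := n + 1) (i := i) hα0 hα1 hβ0 hβ1 (by omega) {j - 1}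
        (by simp; omega) false true
      refine (hmono _ _ ?_).trans (this.trans (by simp [transD]))
      rintro dp ⟨_, hi, hj⟩
      refine ⟨hi, fun e he => ?_⟩
      rw [Finset.mem_singleton] at he
      subst he
      refine ⟨hj.2.resolve_left (by simp only; omega), ?_⟩
      rw [Nat.sub_add_cancel (by omega)]
      exact hj.1
    · rw [prob_eq_zero _ fun dp (h : A (i, j) dp) => hlt h.1]
      positivity
  have hB : ∀ i ∈ Finset.range (m + 1),
      prob (pMarkov α β) (B i) ≤ β / α * (1 - α) ^ t := by
    intro i hi
    rw [Finset.mem_range] at hi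
    by_cases hit : i + t ≤ m
    · have := prob_runStart_and_le (m := n + 1) (i := i) hα0 hα1 hβ0 hβ1 (by omega)
        (Finset.Ico i (i + t)) (by simp only [Finset.mem_Ico]; omega) true true
      refine (hmono _ _ ?_).trans (this.trans (by simp [transD]))
      rintro dp ⟨_, hi, hj⟩
      refine ⟨hi, fun e he => ?_⟩
      rw [Finset.mem_Ico] at he
      exact ⟨hj e (by omega) (by omega), hj (e + 1) (by omega) (by omega)⟩
    · rw [prob_eq_zero _ fun dp (h : B i dp) => hit h.1]
      have : 0 < 1 - α := by linarith
      positivity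
  have hcover : ∀ dp : Fin (n + 1 + 1) → Bool, ¬ Typical α β dp →
      (∃ ij ∈ Finset.range (m + 1) ×ˢ Finset.range (m + 1), A ij dp) ∨
        ∃ i ∈ Finset.range (m + 1), B i dp := by
    intro dp hdp
    rw [or_iff_not_imp_left]
    intro hno
    have hpair : ∀ i j, i < j → j ≤ m → IsRunStart (extend dp) i →
        ¬ IsRunStart (extend dp) j := fun i j hij hj hi hj' =>
      hno ⟨(i, j), by simp only [Finset.mem_product, Finset.mem_range]; omega, hij, hi, hj'⟩
    have hruns : runsCount dp m ≤ 1 := by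
      by_contra hcon
      obtain ⟨i, j, hij, hj, hi, hj'⟩ := exists_runStart_pair dp (not_le.1 hcon)
      exact hpair i j hij hj hi hj'
    have hones : t < onesCount dp m := by
      by_contra hcon
      exact hdp ⟨hruns, not_lt.1 hcon⟩
    rw [onesCount_eq (by omega)] at hones
    obtain ⟨i, hi, h⟩ := exists_long_run hpair hones
    exact ⟨i, by rw [Finset.mem_range]; omega, hi, h⟩
  refine (prob_le_add_prob hp hcover).trans (add_le_add ?_ ?_)
  · refine (prob_le_sum_prob hp _ A fun _ h => h).trans ((Finset.sum_le_sum hA).trans ?_)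
    simp [sq]
  · refine (prob_le_sum_prob hp _ B fun _ h => h).trans ((Finset.sum_le_sum hB).trans ?_)
    simp

lemma neg_logb_two_pos {β : ℝ} (hβ0 : 0 < β) (hβ1 : β < 1) : 0 < -Real.logb 2 β :=
  neg_pos.2 (Real.logb_neg one_lt_two hβ0 hβ1)

lemma pow_onesBound_le {α β : ℝ} (hα0 : 0 < α) (hα1 : α < 1) (hβ0 : 0 < β) (hβ1 : β < 1) :
    (1 - α) ^ onesBound α β ≤ β ^ 2 / (1 - α) := by
  have hq0 : 0 < 1 - α := by linarith
  have hL := neg_logb_two_pos hβ0 hβ1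
  have hlq : Real.logb 2 (1 - α) < 0 := Real.logb_neg one_lt_two hq0 (by linarith)
  have hk : Real.logb 2 (1 - α) * kconst α ≤ -6 := by
    have h : -6 / Real.logb 2 (1 - α) ≤ kconst α := le_max_right _ _
    rw [div_le_iff_of_neg hlq] at h
    linarith
  rw [le_div_iff₀ hq0, ← pow_succ, ← Real.rpow_natCast]
  have ht : kconst α / 3 * (-Real.logb 2 β) ≤ ((onesBound α β + 1 : ℕ) : ℝ) := by
    push_cast
    exact (Nat.lt_floor_add_one _).le
  refine (Real.rpow_le_rpow_of_exponent_ge hq0 (by linarith) ht).trans ?_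
  have h2 : (1 - α) = (2 : ℝ) ^ Real.logb 2 (1 - α) :=
    (Real.rpow_logb two_pos (by norm_num) hq0).symm
  have h3 : β ^ 2 = (2 : ℝ) ^ (2 * Real.logb 2 β) := by
    rw [mul_comm, Real.rpow_mul two_pos.le, Real.rpow_logb two_pos (by norm_num) hβ0]
    norm_cast
  rw [h3, h2, ← Real.rpow_mul two_pos.le]
  refine Real.rpow_le_rpow_of_exponent_le one_le_two ?_
  nlinarith

lemma mlen_add_one_le {α β δ : ℝ} (hδ : 0 < δ) (hβ0 : 0 < β) (hβ1 : β < 1) :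
    (mlen α β : ℝ) + 1 ≤ (kconst α / (Real.log 2 * δ) + 1) * β ^ (-δ) := by
  have hL := neg_logb_two_pos hβ0 hβ1
  have hk : 0 < kconst α := lt_of_lt_of_le (by norm_num) (le_max_left _ _)
  have hl2 : 0 < Real.log 2 := Real.log_pos one_lt_two
  have h1 : (mlen α β : ℝ) ≤ kconst α * (-Real.logb 2 β) :=
    Nat.floor_le (mul_pos hk hL).le
  have h2 : -Real.log β ≤ β ^ (-δ) / δ := by
    have := Real.log_le_rpow_div (inv_pos.2 hβ0).le hδ
    rwa [Real.log_inv, Real.inv_rpow hβ0.le, ← Real.rpow_neg hβ0.le] at this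
  have h3 : 1 ≤ β ^ (-δ) :=
    Real.one_le_rpow_of_pos_of_le_one_of_nonpos hβ0 hβ1.le (by linarith)
  have h4 : kconst α * (-Real.logb 2 β) ≤ kconst α / (Real.log 2 * δ) * β ^ (-δ) := by
    calc kconst α * (-Real.logb 2 β) = kconst α / Real.log 2 * (-Real.log β) := by
          unfold Real.logb; ring
      _ ≤ kconst α / Real.log 2 * (β ^ (-δ) / δ) := by gcongr
      _ = _ := by field_simp
  linarith

/-- Fix `α ∈ (0,1)`, `k = max{6, −6/log₂(1−α)}`, `m = ⌊−k log₂ β⌋`.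
For every `ε > 0` there are `K > 0`, `β₀ > 0` such that for all `β ∈ (0, β₀)` and all
`n > m`: `P(D_0^n is typical) ≥ 1 − K β^{2−ε}`. -/
theorem typicality_high_probability (α : ℝ) (hα : 0 < α ∧ α < 1) (ε : ℝ) (hε : 0 < ε) :
    ∃ K : ℝ, 0 < K ∧ ∃ β₀ : ℝ, 0 < β₀ ∧ ∀ β : ℝ, 0 < β → β < β₀ →
      ∀ n : ℕ, mlen α β < n →
        1 - K * β ^ ((2 : ℝ) - ε)
          ≤ prob (pJoint α β n) (fun ω => Typical α β ω.2) := by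
  obtain ⟨hα0, hα1⟩ := hα
  have hq0 : 0 < 1 - α := by linarith
  have hk : 0 < kconst α := lt_of_lt_of_le (by norm_num) (le_max_left _ _)
  have hl2 : 0 < Real.log 2 := Real.log_pos one_lt_two
  set M : ℝ := kconst α / (Real.log 2 * (ε / 2)) + 1 with hM
  have hM0 : 0 < M := by positivity
  refine ⟨M ^ 2 * (1 / α + 1 / (α * (1 - α))), by positivity, 1, one_pos, ?_⟩
  intro β hβ0 hβ1 n hn
  rw [prob_pJoint_snd]
  have htot := prob_add_prob_not (pMarkov α β (m := n + 1)) (Typical α β (n := n))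
  rw [sum_pMarkov hα0 hβ0] at htot
  have hnot := prob_not_typical_le hα0 hα1 hβ0 hβ1 hn
  have hpow := pow_onesBound_le hα0 hα1 hβ0 hβ1
  have hm := mlen_add_one_le (α := α) (half_pos hε) hβ0 hβ1
  rw [← hM] at hm
  have hm1 : (1 : ℝ) ≤ (mlen α β : ℝ) + 1 := by
    have : (0 : ℝ) ≤ mlen α β := Nat.cast_nonneg _
    linarith
  generalize (mlen α β : ℝ) + 1 = x at hnot hm hm1
  have hx2 : x ^ 2 ≤ M ^ 2 * β ^ (-ε) := by
    calc x ^ 2 ≤ (M * β ^ (-(ε / 2))) ^ 2 := by gcongr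
      _ = M ^ 2 * β ^ (-ε) := by
        rw [mul_pow, ← Real.rpow_mul_natCast hβ0.le]
        congr 2
        push_cast
        ring
  have hβε : β ^ ((2 : ℝ) - ε) = β ^ 2 * β ^ (-ε) := by
    rw [sub_eq_add_neg, Real.rpow_add hβ0]
    norm_cast
  have hbound : x ^ 2 * (β / α * β) + x * (β / α * (1 - α) ^ onesBound α β)
      ≤ M ^ 2 * (1 / α + 1 / (α * (1 - α))) * β ^ ((2 : ℝ) - ε) := by
    calc x ^ 2 * (β / α * β) + x * (β / α * (1 - α) ^ onesBound α β)
        ≤ x ^ 2 * (β / α * β) + x ^ 2 * (β / α * (β / (1 - α))) := by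
          have : β ^ 2 / (1 - α) ≤ β / (1 - α) := by
            gcongr
            nlinarith
          have hxx : x ≤ x ^ 2 := by nlinarith
          have := hpow.trans this
          gcongr
      _ = x ^ 2 * ((1 / α + 1 / (α * (1 - α))) * β ^ 2) := by
          field_simp
      _ ≤ M ^ 2 * β ^ (-ε) * ((1 / α + 1 / (α * (1 - α))) * β ^ 2) := by gcongr
      _ = _ := by rw [hβε]; ring
  linarith
end SyncDeletion
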